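/- arXiv:1910.11356 — 2 statements merged into one kernel-verified Lean document; each statement's English description precedes it below -/
import Mathlib

section
/- The criteria of Table 1 uniquely distinguish the five bivariate causal structures: for all i, j in {1, 2, 3, 4, 5}, structure j (with respect to the ordered pair (X,Y)) satisfies Criterion i if and only if i = j. -/
/-- A mixed graph over a vertex type `V`: `dir a b` means there is a directed
edge `a → b`, and `bidir a b` means there is a bidirected edge `a ↔ b`
(a symmetric relation). -/
structure MixedGraph (V : Type) where
  dir : V → V → Prop
  bidir : V → V → Prop
  bidir_symm : ∀ a b, bidir a b → bidir b a

namespace MixedGraph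

variable {V : Type}

/-- Two vertices are adjacent if they share an edge. -/
def Adj (G : MixedGraph V) (a b : V) : Prop :=
  G.dir a b ∨ G.dir b a ∨ G.bidir a b

/-- There is an edge between `a` and `b` with an arrowhead at `b`:
either a directed edge into `b` or a bidirected edge. -/
def ArrowheadAt (G : MixedGraph V) (a b : V) : Prop :=
  G.dir a b ∨ G.bidir a b

/-- `a` is a (strict) ancestor of `b`: there is a directed path from `a` to `b`. -/
def Anc (G : MixedGraph V) (a b : V) : Prop :=
  Relation.TransGen G.dir a b

/-- A path is a sequence of distinct vertices, consecutive ones adjacent. -/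
def IsPath (G : MixedGraph V) (p : List V) : Prop :=
  List.Chain' G.Adj p ∧ p.Nodup

/-- An internal vertex `v` with neighbours `a` and `c` on a path is a collider
if both adjacent edges have arrowheads at `v`. -/
def ColliderTriple (G : MixedGraph V) (a v c : V) : Prop :=
  G.ArrowheadAt a v ∧ G.ArrowheadAt c v

/-- `p` is a path between `X` and `Y` that is active with respect to `Z`:
every collider on it is in `Z` or has a descendant in `Z`, and every
non-collider on it is not in `Z`. (Consecutive internal triples of a list
are exactly its infixes of length three.) -/
def ActivePath (G : MixedGraph V) (Z : Set V) (X Y : V) (p : List V) : Prop :=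
  G.IsPath p ∧ p.head? = some X ∧ p.getLast? = some Y ∧
    ∀ a v c, [a, v, c] <:+: p →
      (G.ColliderTriple a v c → v ∈ Z ∨ ∃ d ∈ Z, G.Anc v d) ∧
      (¬ G.ColliderTriple a v c → v ∉ Z)

/-- `X` and `Y` are m-separated given `Z` if there is no active path between them. -/
def MSep (G : MixedGraph V) (Z : Set V) (X Y : V) : Prop :=
  ¬ ∃ p, G.ActivePath Z X Y p

/-- `G_{W̄}`: delete every edge with an arrowhead at `W`. -/
def removeIncoming (G : MixedGraph V) (W : V) : MixedGraph V where
  dir a b := G.dir a b ∧ b ≠ W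
  bidir a b := G.bidir a b ∧ a ≠ W ∧ b ≠ W
  bidir_symm a b h := ⟨G.bidir_symm a b h.1, h.2.2, h.2.1⟩

/-- `G_{W_}`: delete every edge with a tail at `W`, i.e. every directed
edge out of `W`. -/
def removeOutgoing (G : MixedGraph V) (W : V) : MixedGraph V where
  dir a b := G.dir a b ∧ a ≠ W
  bidir := G.bidir
  bidir_symm := G.bidir_symm

/-- Criterion 1 for the ordered pair `(A,B)`: pattern (T,F,F,T) of
m-separation of `A, B` given `∅` in `(G_{B̄}, G_{B_}, G_{Ā}, G_{A_})`. -/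
def Criterion1 (G : MixedGraph V) (A B : V) : Prop :=
  (G.removeIncoming B).MSep ∅ A B ∧ ¬ (G.removeOutgoing B).MSep ∅ A B ∧
    ¬ (G.removeIncoming A).MSep ∅ A B ∧ (G.removeOutgoing A).MSep ∅ A B

/-- Criterion 2: pattern (F,T,T,F). -/
def Criterion2 (G : MixedGraph V) (A B : V) : Prop :=
  ¬ (G.removeIncoming B).MSep ∅ A B ∧ (G.removeOutgoing B).MSep ∅ A B ∧
    (G.removeIncoming A).MSep ∅ A B ∧ ¬ (G.removeOutgoing A).MSep ∅ A B

/-- Criterion 3: pattern (T,F,T,F). -/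
def Criterion3 (G : MixedGraph V) (A B : V) : Prop :=
  (G.removeIncoming B).MSep ∅ A B ∧ ¬ (G.removeOutgoing B).MSep ∅ A B ∧
    (G.removeIncoming A).MSep ∅ A B ∧ ¬ (G.removeOutgoing A).MSep ∅ A B

/-- Criterion 4: pattern (T,F,F,F). -/
def Criterion4 (G : MixedGraph V) (A B : V) : Prop :=
  (G.removeIncoming B).MSep ∅ A B ∧ ¬ (G.removeOutgoing B).MSep ∅ A B ∧
    ¬ (G.removeIncoming A).MSep ∅ A B ∧ ¬ (G.removeOutgoing A).MSep ∅ A B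

/-- Criterion 5: pattern (F,F,T,F). -/
def Criterion5 (G : MixedGraph V) (A B : V) : Prop :=
  ¬ (G.removeIncoming B).MSep ∅ A B ∧ ¬ (G.removeOutgoing B).MSep ∅ A B ∧
    (G.removeIncoming A).MSep ∅ A B ∧ ¬ (G.removeOutgoing A).MSep ∅ A B

end MixedGraph

/-- Vertices for the bivariate structures: observed `X`, `Y` and latent `L`. -/
inductive Vtx : Type
  | X | Y | L

/-- Structure (a): the single directed edge `X → Y`. -/
def Ga : MixedGraph Vtx where
  dir a b := a = Vtx.X ∧ b = Vtx.Y
  bidir _ _ := False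
  bidir_symm _ _ h := h.elim

/-- Structure (b): the single directed edge `Y → X`. -/
def Gb : MixedGraph Vtx where
  dir a b := a = Vtx.Y ∧ b = Vtx.X
  bidir _ _ := False
  bidir_symm _ _ h := h.elim

/-- Structure (c): latent common cause, edges `L → X` and `L → Y`. -/
def Gc : MixedGraph Vtx where
  dir a b := (a = Vtx.L ∧ b = Vtx.X) ∨ (a = Vtx.L ∧ b = Vtx.Y)
  bidir _ _ := False
  bidir_symm _ _ h := h.elim

/-- Structure (d): edges `X → Y`, `L → X`, `L → Y`. -/
def Gd : MixedGraph Vtx where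
  dir a b := (a = Vtx.X ∧ b = Vtx.Y) ∨ (a = Vtx.L ∧ b = Vtx.X) ∨ (a = Vtx.L ∧ b = Vtx.Y)
  bidir _ _ := False
  bidir_symm _ _ h := h.elim

/-- Structure (e): edges `Y → X`, `L → X`, `L → Y`. -/
def Ge : MixedGraph Vtx where
  dir a b := (a = Vtx.Y ∧ b = Vtx.X) ∨ (a = Vtx.L ∧ b = Vtx.X) ∨ (a = Vtx.L ∧ b = Vtx.Y)
  bidir _ _ := False
  bidir_symm _ _ h := h.elim

/-- The five bivariate causal structures, indexed by `Fin 5`. -/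
def structures : Fin 5 → MixedGraph Vtx := ![Ga, Gb, Gc, Gd, Ge]

/-- The five criteria of Table 1, indexed by `Fin 5`. -/
def criteria : Fin 5 → MixedGraph Vtx → Vtx → Vtx → Prop :=
  ![MixedGraph.Criterion1, MixedGraph.Criterion2, MixedGraph.Criterion3,
    MixedGraph.Criterion4, MixedGraph.Criterion5]

/-- In a mixed graph on `X`, `Y`, `L`, the vertices `X` and `Y` are m-separated given `∅`
exactly when they are not adjacent and `L` does not join them as a non-collider. -/
theorem MixedGraph.mSep_empty_iff (G : MixedGraph Vtx) :
    G.MSep ∅ Vtx.X Vtx.Y ↔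
      ¬ G.Adj Vtx.X Vtx.Y ∧
        ¬ (G.Adj Vtx.X Vtx.L ∧ G.Adj Vtx.L Vtx.Y ∧ ¬ G.ColliderTriple Vtx.X Vtx.L Vtx.Y) := by
  rw [← not_or, MSep, not_iff_not]
  constructor
  · rintro ⟨p, ⟨hadj, hnodup⟩, hhead, hlast, hactive⟩
    match p with
    | [] => simp at hhead
    | [a] => simp_all
    | [a, b] =>
      obtain rfl : a = Vtx.X := by simpa using hhead
      obtain rfl : b = Vtx.Y := by simpa using hlast
      exact Or.inl (List.isChain_pair.1 hadj)
    | [a, b, c] =>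
      obtain rfl : a = Vtx.X := by simpa using hhead
      obtain rfl : c = Vtx.Y := by simpa using hlast
      have hb := (hactive _ _ _ List.infix_rfl).1
      cases b with
      | X => simp at hnodup
      | Y => simp at hnodup
      | L =>
        have h := List.isChain_cons_cons.1 hadj
        exact Or.inr ⟨h.1, List.isChain_pair.1 h.2, fun hc => by simpa using hb hc⟩
    | a :: b :: c :: d :: l =>
      cases a <;> cases b <;> cases c <;> cases d <;> simp at hnodup
  · rintro (h | ⟨h₁, h₂, hc⟩)
    · refine ⟨[Vtx.X, Vtx.Y], ⟨List.isChain_pair.2 h, by simp⟩, rfl, rfl, fun a v c ht => ?_⟩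
      simpa using ht.length_le
    · refine ⟨[Vtx.X, Vtx.L, Vtx.Y],
        ⟨List.isChain_cons_cons.2 ⟨h₁, List.isChain_pair.2 h₂⟩, by simp⟩, rfl, rfl,
        fun a v c ht => ?_⟩
      have he := ht.eq_of_length rfl
      simp only [List.cons.injEq, and_true] at he
      obtain ⟨rfl, rfl, rfl⟩ := he
      exact ⟨fun h => absurd h hc, fun _ => Set.notMem_empty _⟩

/-- The criteria of Table 1 uniquely distinguish the five bivariate structures:
structure `j` satisfies Criterion `i` for the ordered pair `(X,Y)` iff `i = j`. -/
theorem statement5 :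
    ∀ i j : Fin 5, criteria i (structures j) Vtx.X Vtx.Y ↔ i = j := by
  intro i j
  fin_cases i <;> fin_cases j <;>
    simp [criteria, structures, MixedGraph.Criterion1, MixedGraph.Criterion2,
      MixedGraph.Criterion3, MixedGraph.Criterion4, MixedGraph.Criterion5,
      MixedGraph.mSep_empty_iff, MixedGraph.Adj, MixedGraph.ColliderTriple,
      MixedGraph.ArrowheadAt, MixedGraph.removeIncoming, MixedGraph.removeOutgoing,
      Ga, Gb, Gc, Gd, Ge]
end

section
/- Let G be an ancestral mixed graph and let X and Y be distinct vertices. If there is an inducing path between X and Y in G relative to the empty set, then X and Y cannot be m-separated: for every set Z of vertices with X, Y not in Z, X and Y are not m-separated given Z in G. -/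
/-- A mixed graph is ancestral if it has no directed cycles and for every
bidirected edge `a ↔ b`, `a` is not an ancestor of `b`. -/
def MixedGraph.IsAncestral {V : Type} (G : MixedGraph V) : Prop :=
  (∀ v, ¬ G.Anc v v) ∧ ∀ a b, G.bidir a b → ¬ G.Anc a b

/-- An inducing path between `X` and `Y` relative to the empty set: a path in
which every non-endpoint vertex is a collider and is an ancestor of `X` or of `Y`. -/
def MixedGraph.InducingPathEmpty {V : Type} (G : MixedGraph V) (X Y : V)
    (p : List V) : Prop :=
  G.IsPath p ∧ p.head? = some X ∧ p.getLast? = some Y ∧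
    ∀ a v c, [a, v, c] <:+: p →
      G.ColliderTriple a v c ∧ (G.Anc v X ∨ G.Anc v Y)

namespace MixedGraph

variable {V : Type}

/-- `v` is in `Z` or has a descendant in `Z`. -/
def InAncestors (G : MixedGraph V) (Z : Set V) (v : V) : Prop :=
  v ∈ Z ∨ ∃ d ∈ Z, G.Anc v d

/-- The local activity condition at the middle vertex of a triple. -/
def ActiveTriple (G : MixedGraph V) (Z : Set V) (a v c : V) : Prop :=
  (G.ColliderTriple a v c → G.InAncestors Z v) ∧ (¬ G.ColliderTriple a v c → v ∉ Z)

/-- `f 0, …, f n` is an active walk from `u` to `w`; vertices may repeat. -/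
def IsActiveWalk (G : MixedGraph V) (Z : Set V) (u w : V) (n : ℕ) (f : ℕ → V) : Prop :=
  f 0 = u ∧ f n = w ∧ (∀ k < n, G.Adj (f k) (f (k + 1))) ∧
    ∀ k, k + 1 < n → G.ActiveTriple Z (f k) (f (k + 1)) (f (k + 2))

/-- Some active walk joins `u` and `w`. -/
def ActivelyConnected (G : MixedGraph V) (Z : Set V) (u w : V) : Prop :=
  ∃ n f, G.IsActiveWalk Z u w n f

variable {G : MixedGraph V} {Z : Set V}

lemma Adj.symm {a b : V} (h : G.Adj a b) : G.Adj b a := by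
  rcases h with h | h | h
  · exact Or.inr (Or.inl h)
  · exact Or.inl h
  · exact Or.inr (Or.inr (G.bidir_symm _ _ h))

lemma Adj.dir_of_not_arrowheadAt {a b : V} (h : G.Adj a b) (hn : ¬ G.ArrowheadAt b a) :
    G.dir a b := by
  rcases h with h | h | h
  · exact h
  · exact (hn (Or.inl h)).elim
  · exact (hn (Or.inr (G.bidir_symm _ _ h))).elim

lemma IsAncestral.not_arrowheadAt_of_dir (hG : G.IsAncestral) {a b : V} (h : G.dir a b) :
    ¬ G.ArrowheadAt b a := by
  rintro (h' | h')
  · exact hG.1 a (.tail (.single h) h')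
  · exact hG.2 a b (G.bidir_symm _ _ h') (.single h)

lemma InAncestors.of_dir {a b : V} (h : G.dir a b) (hb : G.InAncestors Z b) :
    G.InAncestors Z a := by
  rcases hb with hb | ⟨d, hd, hbd⟩
  · exact Or.inr ⟨b, hb, .single h⟩
  · exact Or.inr ⟨d, hd, .head h hbd⟩

lemma ActiveTriple.symm {a v c : V} (h : G.ActiveTriple Z a v c) : G.ActiveTriple Z c v a :=
  ⟨fun hc => h.1 hc.symm, fun hc => h.2 fun hc' => hc hc'.symm⟩

lemma ActivelyConnected.symm {u w : V} (h : G.ActivelyConnected Z u w) :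
    G.ActivelyConnected Z w u := by
  obtain ⟨n, f, h0, hn, hadj, htr⟩ := h
  refine ⟨n, fun k => f (n - k), by simpa using hn, by simpa using h0, fun k hk => ?_,
    fun k hk => ?_⟩
  · have h := (hadj (n - (k + 1)) (by omega)).symm
    rwa [show n - (k + 1) + 1 = n - k by omega] at h
  · have h := (htr (n - (k + 2)) (by omega)).symm
    rwa [show n - (k + 2) + 1 = n - (k + 1) by omega,
      show n - (k + 2) + 2 = n - k by omega] at h

lemma ActivelyConnected.prepend (hG : G.IsAncestral) {u v w : V} (huv : G.dir u v)
    (hu : u ∉ Z) (h : G.ActivelyConnected Z u w) : G.ActivelyConnected Z v w := by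
  obtain ⟨n, f, h0, hn, hadj, htr⟩ := h
  refine ⟨n + 1, fun k => Nat.casesOn k v f, rfl, hn, ?_, ?_⟩
  · rintro (_ | k) hk
    · subst h0
      exact Or.inr (Or.inl huv)
    · exact hadj k (by omega)
  · rintro (_ | k) hk
    · subst h0
      exact ⟨fun hc => (hG.not_arrowheadAt_of_dir huv hc.1).elim, fun _ => hu⟩
    · exact htr k (by omega)

lemma ActivelyConnected.of_anc (hG : G.IsAncestral) {u v w : V} (huv : G.Anc u v)
    (hu : ¬ G.InAncestors Z u) (h : G.ActivelyConnected Z u w) : G.ActivelyConnected Z v w := by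
  suffices ¬ G.InAncestors Z v ∧ G.ActivelyConnected Z v w from this.2
  have step : ∀ {a b}, G.dir a b → ¬ G.InAncestors Z a ∧ G.ActivelyConnected Z a w →
      ¬ G.InAncestors Z b ∧ G.ActivelyConnected Z b w := fun hab ha =>
    ⟨fun hb => ha.1 (hb.of_dir hab), ha.2.prepend hG hab fun hz => ha.1 (Or.inl hz)⟩
  induction huv with
  | single hd => exact step hd ⟨hu, h⟩
  | tail _ hd ih => exact step hd ih

/-- If an active walk revisits a vertex, the loop in between can be cut out. -/
lemma IsActiveWalk.exists_shorter (hG : G.IsAncestral) {u w : V} {n : ℕ} {f : ℕ → V}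
    (h : G.IsActiveWalk Z u w n f) {i j : ℕ} (hij : i < j) (hjn : j ≤ n) (hf : f i = f j) :
    ∃ m < n, ∃ g, G.IsActiveWalk Z u w m g := by
  obtain ⟨h0, hn, hadj, htr⟩ := h
  have hpost : ∀ k, i ≤ k → (if k ≤ i then f k else f (k + (j - i))) = f (k + (j - i)) := by
    intro k hk
    split_ifs with hki
    · rw [show k = i by omega, hf]
      congr 1
      omega
    · rfl
  refine ⟨n - (j - i), by omega, fun k => if k ≤ i then f k else f (k + (j - i)), by simpa using h0,
    ?_, fun k hk => ?_, fun k hk => ?_⟩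
  · simp only [hpost (n - (j - i)) (by omega)]
    rw [show n - (j - i) + (j - i) = n by omega, hn]
  · rcases lt_or_ge k i with hki | hki
    · simpa [hki.le, Nat.succ_le_of_lt hki] using hadj k (by omega)
    · simp only [hpost k hki, hpost (k + 1) (by omega)]
      have h := hadj (k + (j - i)) (by omega)
      rwa [show k + (j - i) + 1 = k + 1 + (j - i) by omega] at h
  · rcases lt_trichotomy (k + 1) i with hki | rfl | hki
    · simpa [show k ≤ i by omega, show k + 1 ≤ i by omega, show k + 2 ≤ i by omega]
        using htr k (by omega)
    · have hfst := htr k (by omega)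
      have hlst := htr (j - 1) (by omega)
      rw [show j - 1 + 1 = j by omega, show j - 1 + 2 = j + 1 by omega, ← hf] at hlst
      simp only [show k ≤ k + 1 by omega, le_refl, if_true, hpost (k + 2) (by omega)]
      rw [show k + 2 + (j - (k + 1)) = j + 1 by omega]
      refine ⟨fun hc => ?_, fun hc => ?_⟩
      · by_contra hz
        have hchain : ∀ m, k + 1 + m < j →
            G.Anc (f (k + 1)) (f (k + 1 + m + 1)) ∧ G.dir (f (k + 1 + m)) (f (k + 1 + m + 1)) ∧
              ¬ G.InAncestors Z (f (k + 1 + m + 1)) := by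
          intro m
          induction m with
          | zero =>
            intro hm
            have hd : G.dir (f (k + 1)) (f (k + 2)) :=
              (hadj (k + 1) (by omega)).dir_of_not_arrowheadAt
                fun ha => hz (hfst.1 ⟨hc.1, ha⟩)
            exact ⟨.single hd, hd, fun hb => hz (hb.of_dir hd)⟩
          | succ m ih =>
            intro hm
            obtain ⟨hanc, hd, hnz⟩ := ih (by omega)
            have hd' : G.dir (f (k + 1 + m + 1)) (f (k + 1 + m + 2)) :=
              (hadj (k + 1 + m + 1) (by omega)).dir_of_not_arrowheadAt
                fun ha => hnz ((htr (k + 1 + m) (by omega)).1 ⟨Or.inl hd, ha⟩)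
            exact ⟨hanc.tail hd', hd', fun hb => hnz (hb.of_dir hd')⟩
        have hcycle := (hchain (j - (k + 1) - 1) (by omega)).1
        rw [show k + 1 + (j - (k + 1) - 1) + 1 = j by omega, ← hf] at hcycle
        exact hG.1 _ hcycle
      · by_cases ha : G.ArrowheadAt (f k) (f (k + 1))
        · exact hlst.2 fun hc' => hc ⟨ha, hc'.2⟩
        · exact hfst.2 fun hc' => ha hc'.1
    · simp only [hpost k (by omega), hpost (k + 1) (by omega), hpost (k + 2) (by omega)]
      have h := htr (k + (j - i)) (by omega)
      rwa [show k + (j - i) + 1 = k + 1 + (j - i) by omega,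
        show k + (j - i) + 2 = k + 2 + (j - i) by omega] at h

/-- A shortest active walk is an active path. -/
lemma ActivelyConnected.exists_activePath (hG : G.IsAncestral) {u w : V}
    (h : G.ActivelyConnected Z u w) : ∃ p, G.ActivePath Z u w p := by
  classical
  obtain ⟨f, hf⟩ := Nat.find_spec h
  have hmin : ∀ m < Nat.find h, ¬ ∃ g, G.IsActiveWalk Z u w m g := fun m hm => Nat.find_min h hm
  generalize Nat.find h = n at hf hmin
  have hinj : ∀ i j, i < j → j ≤ n → f i ≠ f j := by
    intro i j hij hjn he
    obtain ⟨m, hm, g⟩ := hf.exists_shorter hG hij hjn he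
    exact hmin m hm g
  obtain ⟨h0, hn, hadj, htr⟩ := hf
  refine ⟨(List.range (n + 1)).map f, ⟨?_, ?_⟩, ?_, ?_, ?_⟩
  · refine List.isChain_iff_getElem.2 fun i hi => ?_
    simp only [List.length_map, List.length_range] at hi
    simpa using hadj i (by omega)
  · refine List.Nodup.map_on (fun i hi j hj he => ?_) List.nodup_range
    simp only [List.mem_range] at hi hj
    rcases lt_trichotomy i j with hij | hij | hij
    · exact (hinj i j hij (by omega) he).elim
    · exact hij
    · exact (hinj j i hij (by omega) he.symm).elim
  · simp [List.range_succ_eq_map, h0]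
  · simp [List.range_succ, hn]
  · intro a v c hi
    obtain ⟨k, hk, hget⟩ := List.infix_iff_getElem?.1 hi
    simp only [List.length_map, List.length_range, List.length_cons, List.length_nil] at hk
    have ha := hget 0 (by simp)
    have hv := hget 1 (by simp)
    have hc := hget 2 (by simp)
    simp [show k < n + 1 by omega] at ha
    simp [show 1 + k < n + 1 by omega] at hv
    simp [show 2 + k < n + 1 by omega] at hc
    subst ha hv hc
    rw [add_comm 1 k, add_comm 2 k]
    exact htr k (by omega)

/-- An inducing path yields an active walk for every conditioning set: take a shortest stretch of
it all of whose inner vertices are ancestors of `Z`, and leave it at both ends along directed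
paths that avoid `Z`. -/
lemma InducingPathEmpty.activelyConnected (hG : G.IsAncestral) {X Y : V} (hXY : X ≠ Y)
    {p : List V} (hp : G.InducingPathEmpty X Y p) : G.ActivelyConnected Z X Y := by
  obtain ⟨⟨hchain, -⟩, hhead, hlast, htr⟩ := hp
  obtain ⟨n, f, h0, hn, hadj, hind⟩ : ∃ n, ∃ f : ℕ → V, f 0 = X ∧ f n = Y ∧
      (∀ k < n, G.Adj (f k) (f (k + 1))) ∧ ∀ k, k + 1 < n →
        G.ColliderTriple (f k) (f (k + 1)) (f (k + 2)) ∧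
          (G.Anc (f (k + 1)) X ∨ G.Anc (f (k + 1)) Y) := by
    have hget : ∀ k (hk : k < p.length), p.getD k X = p[k] := fun k hk => by simp [hk]
    refine ⟨p.length - 1, fun k => p.getD k X, ?_, ?_, fun k hk => ?_, fun k hk => htr _ _ _ ?_⟩
    · cases p <;> simp_all
    · rw [List.getLast?_eq_getElem?] at hlast
      simp [hlast]
    · simp only [hget k (by omega), hget (k + 1) (by omega)]
      exact List.isChain_iff_getElem.1 hchain k (by omega)
    · refine List.infix_iff_getElem?.2 ⟨k, by simp; omega, fun i hi => ?_⟩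
      simp only [List.length_cons, List.length_nil] at hi
      interval_cases i
      · simp [show k < p.length by omega]
      · simp [show k + 1 < p.length by omega, add_comm 1 k]
      · simp [show k + 2 < p.length by omega, add_comm 2 k]
  have hpos : 0 < n := by
    rcases Nat.eq_zero_or_pos n with rfl | hpos
    · exact (hXY (h0.symm.trans hn)).elim
    · exact hpos
  suffices ∀ d i j, j - i = d → i < j → j ≤ n →
      (f i = X ∨ ¬ G.InAncestors Z (f i) ∧ G.Anc (f i) X) →
      (f j = Y ∨ ¬ G.InAncestors Z (f j) ∧ G.Anc (f j) Y) → G.ActivelyConnected Z X Y from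
    this _ 0 n rfl hpos le_rfl (Or.inl h0) (Or.inl hn)
  intro d
  induction d using Nat.strong_induction_on with
  | _ d ih =>
    intro i j hd hij hjn hi hj
    by_cases hall : ∀ k, i < k → k < j → G.InAncestors Z (f k)
    · have hseg : G.ActivelyConnected Z (f i) (f j) := by
        refine ⟨j - i, fun k => f (i + k), rfl, ?_, fun k hk => hadj (i + k) (by omega),
          fun k hk => ⟨fun _ => hall _ (by omega) (by omega),
            fun hc => (hc (hind (i + k) (by omega)).1).elim⟩⟩
        simp only [show i + (j - i) = j by omega]
      have hleft : G.ActivelyConnected Z X (f j) := by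
        rcases hi with hi | hi
        · rwa [hi] at hseg
        · exact hseg.of_anc hG hi.2 hi.1
      rcases hj with hj | hj
      · rwa [hj] at hleft
      · exact (hleft.symm.of_anc hG hj.2 hj.1).symm
    · push Not at hall
      obtain ⟨k, hik, hkj, hk⟩ := hall
      have hanc := (hind (k - 1) (by omega)).2
      rw [show k - 1 + 1 = k by omega] at hanc
      rcases hanc with hX | hY
      · exact ih (j - k) (by omega) k j rfl hkj hjn (Or.inr ⟨hk, hX⟩) hj
      · exact ih (k - i) (by omega) i k rfl hik (by omega) hi (Or.inr ⟨hk, hY⟩)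

end MixedGraph

/-- If there is an inducing path between distinct vertices `X` and `Y` of an
ancestral mixed graph relative to `∅`, then `X` and `Y` cannot be m-separated:
for every `Z` with `X, Y ∉ Z`, `X` and `Y` are not m-separated given `Z`. -/
theorem statement10 {V : Type} [Fintype V] (G : MixedGraph V)
    (hG : G.IsAncestral) (X Y : V) (hXY : X ≠ Y)
    (hip : ∃ p, G.InducingPathEmpty X Y p) :
    ∀ Z : Set V, X ∉ Z → Y ∉ Z → ¬ G.MSep Z X Y := by
  intro Z _ _ hsep
  obtain ⟨p, hp⟩ := hip
  exact hsep ((hp.activelyConnected hG hXY).exists_activePath hG)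
end
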